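/- If F_2(t_0) < 1, then there exists a unique y_2 ∈ B with y_2 = Φ_2 y_2, and the iterates y_{2,K} (defined by y_{2,0} ≡ 0 and y_{2,K} = Φ_2 y_{2,K−1}) converge to y_2 in the supremum norm: lim_{K→∞} ‖y_{2,K} − y_2‖ = 0. -/

import Mathlib

open MeasureTheory Set Filter Topology
open scoped Classical

noncomputable section

/-- The domain `D = {(a,b,c) ∈ [0,∞) × [0,t₀] × [0,t₀] : b + c ≤ t₀}`. -/
def Dset (t0 : ℝ) : Set (ℝ × ℝ × ℝ) :=
  {p | 0 ≤ p.1 ∧ p.2.1 ∈ Icc (0 : ℝ) t0 ∧ p.2.2 ∈ Icc (0 : ℝ) t0 ∧ p.2.1 + p.2.2 ≤ t0}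

/-- Extension (by `0`) of a bounded continuous function on `D` to all of `ℝ³`. -/
def extD {t0 : ℝ} (δ : BoundedContinuousFunction (Dset t0) ℝ) : ℝ × ℝ × ℝ → ℝ :=
  fun p => if h : p ∈ Dset t0 then δ ⟨p, h⟩ else 0

/-- `Δ₂(a) = E[g₂(a + X₂) - g₂(a)]`, where `ν` is the law of the fish weight `X₂`. -/
def DeltaFn (g : ℝ → ℝ) (ν : Measure ℝ) (a : ℝ) : ℝ := ∫ x, (g (a + x) - g a) ∂ν

/-- `φ_{2,δ}(a,b,c,r) = ∫_0^r (1-F₂(z)) { α₂(z)[Δ₂(a) + ∫ δ(a+x,b+z,c-z) dH₂(x)] - c₂'(b+z) } dz`,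
with `α₂ = f₂ / (1 - F₂)` and `ν` the law of the fish weight. -/
def phiFn (F2 f2 g2 c2 : ℝ → ℝ) (ν : Measure ℝ) (δ : ℝ × ℝ × ℝ → ℝ) (a b c r : ℝ) : ℝ :=
  ∫ z in Ioc (0 : ℝ) r,
    (1 - F2 z) * (f2 z / (1 - F2 z) * (DeltaFn g2 ν a + ∫ x, δ (a + x, b + z, c - z) ∂ν)
      - deriv c2 (b + z))

lemma extD_measurable {t0 : ℝ} (δ : BoundedContinuousFunction (Dset t0) ℝ) :
    Measurable (extD δ) := by
  have hD : MeasurableSet (Dset t0) := by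
    apply IsClosed.measurableSet
    have : Dset t0 = {p : ℝ × ℝ × ℝ | 0 ≤ p.1} ∩ ({p | 0 ≤ p.2.1} ∩ {p | p.2.1 ≤ t0}) ∩
        ({p | 0 ≤ p.2.2} ∩ {p | p.2.2 ≤ t0}) ∩ {p | p.2.1 + p.2.2 ≤ t0} := by
      ext p
      simp only [Dset, mem_ofPred_eq, mem_Icc, mem_inter_iff]
      tauto
    rw [this]
    refine IsClosed.inter (IsClosed.inter (IsClosed.inter ?_ (IsClosed.inter ?_ ?_))
      (IsClosed.inter ?_ ?_)) ?_ <;> exact isClosed_le (by fun_prop) (by fun_prop)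
  unfold extD
  exact Measurable.dite (s := Dset t0) (f := fun p => δ p) (g := fun _ => 0)
    δ.continuous.measurable measurable_const hD

lemma extD_bound {t0 : ℝ} (δ : BoundedContinuousFunction (Dset t0) ℝ) (p) :
    ‖extD δ p‖ ≤ ‖δ‖ := by
  unfold extD
  split_ifs with h
  · exact δ.norm_coe_le_norm _
  · simp

lemma extD_le {t0 : ℝ} (δ η : BoundedContinuousFunction (Dset t0) ℝ) (p) :
    extD δ p ≤ extD η p + dist δ η := by
  unfold extD
  split_ifs with h
  · have h1 := BoundedContinuousFunction.dist_coe_le_dist (f := δ) (g := η) ⟨p, h⟩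
    rw [Real.dist_eq] at h1
    linarith [le_abs_self (δ ⟨p, h⟩ - η ⟨p, h⟩)]
  · simp

lemma extD_section_integrable {t0 : ℝ} (δ : BoundedContinuousFunction (Dset t0) ℝ)
    (ν : Measure ℝ) [IsProbabilityMeasure ν] (a u v : ℝ) :
    Integrable (fun x => extD δ (a + x, u, v)) ν := by
  refine Integrable.of_bound (C := ‖δ‖) ?_ (ae_of_all _ fun x => extD_bound δ _)
  exact ((extD_measurable δ).comp (by fun_prop)).aestronglyMeasurable

lemma inner_measurable {t0 : ℝ} (δ : BoundedContinuousFunction (Dset t0) ℝ)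
    (ν : Measure ℝ) [IsProbabilityMeasure ν] (a b c : ℝ) :
    StronglyMeasurable (fun z => ∫ x, extD δ (a + x, b + z, c - z) ∂ν) := by
  have h : StronglyMeasurable (fun p : ℝ × ℝ => extD δ (a + p.2, b + p.1, c - p.1)) :=
    ((extD_measurable δ).comp (by fun_prop)).stronglyMeasurable
  exact h.integral_prod_right

lemma inner_bound {t0 : ℝ} (δ : BoundedContinuousFunction (Dset t0) ℝ)
    (ν : Measure ℝ) [IsProbabilityMeasure ν] (a b c z : ℝ) :
    ‖∫ x, extD δ (a + x, b + z, c - z) ∂ν‖ ≤ ‖δ‖ := by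
  have := norm_integral_le_of_norm_le_const (μ := ν) (C := ‖δ‖)
    (f := fun x => extD δ (a + x, b + z, c - z)) (ae_of_all _ fun x => extD_bound δ _)
  simpa using this

lemma inner_le {t0 : ℝ} (δ η : BoundedContinuousFunction (Dset t0) ℝ)
    (ν : Measure ℝ) [IsProbabilityMeasure ν] (a u v : ℝ) :
    ∫ x, extD δ (a + x, u, v) ∂ν ≤ (∫ x, extD η (a + x, u, v) ∂ν) + dist δ η := by
  have h := integral_mono (μ := ν) (extD_section_integrable δ ν a u v)
    ((extD_section_integrable η ν a u v).add (integrable_const (dist δ η)))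
    (fun x => extD_le δ η (a + x, u, v))
  simp only [Pi.add_apply] at h
  rw [integral_add (extD_section_integrable η ν a u v) (integrable_const _)] at h
  simpa using h

/-- **Existence and uniqueness of the fixed point of `Φ₂`, and convergence of the
iterates**: if `F₂(t₀) < 1` then there is a unique `y₂ ∈ B` with `Φ₂ y₂ = y₂`, and the
iterates `y_{2,0} ≡ 0`, `y_{2,K} = Φ₂ y_{2,K-1}` (i.e. `y_{2,K} = Φ₂^[K] 0`) converge
to `y₂` in the supremum norm. -/
theorem Phi2_fixed_point
    (t0 G2 C2 : ℝ) (ht0 : 0 < t0)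
    (F2 f2 : ℝ → ℝ) (hf2nn : ∀ z, 0 ≤ f2 z) (hf2m : Measurable f2)
    (hF2 : ∀ z, F2 z = ∫ x in Iic z, f2 x)
    (hF2one : Tendsto F2 atTop (nhds 1)) (hF2t0 : F2 t0 < 1)
    (ν : Measure ℝ) [IsProbabilityMeasure ν] (hν : ν (Iio 0) = 0)
    (g2 c2 : ℝ → ℝ) (hg2c : Continuous g2)
    (hg2b : ∀ x ∈ Ici (0 : ℝ), g2 x ∈ Icc 0 G2)
    (hc2c : Continuous c2) (hc2d : Differentiable ℝ c2)
    (hc2dc : Continuous (deriv c2)) (hc2db : ∃ L, ∀ t, |deriv c2 t| ≤ L)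
    (hc2b : ∀ t ∈ Icc (0 : ℝ) t0, c2 t ∈ Icc 0 C2)
    (Phi : BoundedContinuousFunction (Dset t0) ℝ → BoundedContinuousFunction (Dset t0) ℝ)
    (hPhi : ∀ (δ : BoundedContinuousFunction (Dset t0) ℝ) (q : Dset t0),
      Phi δ q = sSup ((fun r => phiFn F2 f2 g2 c2 ν (extD δ)
        (q : ℝ × ℝ × ℝ).1 (q : ℝ × ℝ × ℝ).2.1 (q : ℝ × ℝ × ℝ).2.2 r) ''
        Icc 0 (q : ℝ × ℝ × ℝ).2.2)) :
    (∃! y2 : BoundedContinuousFunction (Dset t0) ℝ, Phi y2 = y2) ∧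
    ∀ y2 : BoundedContinuousFunction (Dset t0) ℝ, Phi y2 = y2 →
      Tendsto (fun K : ℕ => ‖Phi^[K] 0 - y2‖) atTop (nhds 0) := by
  have hint : ∀ z, IntegrableOn f2 (Iic z) := by
    intro z
    have h1 : ∀ᶠ w in atTop, 0 < F2 w := hF2one.eventually (lt_mem_nhds one_pos)
    obtain ⟨w, hw, hzw⟩ := (h1.and (eventually_ge_atTop z)).exists
    have h2 : IntegrableOn f2 (Iic w) := by
      by_contra hn
      rw [hF2, integral_undef hn] at hw
      exact lt_irrefl _ hw
    exact h2.mono_set (Iic_subset_Iic.2 hzw)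
  have hmono : Monotone F2 := by
    intro x y hxy
    rw [hF2, hF2]
    exact setIntegral_mono_set (hint y) (ae_of_all _ hf2nn) (Iic_subset_Iic.2 hxy).eventuallyLE
  have hnn : ∀ z, 0 ≤ F2 z := fun z => by
    rw [hF2]
    exact integral_nonneg hf2nn
  obtain ⟨L, hL⟩ := hc2db
  have hI : ∀ (δ : BoundedContinuousFunction (Dset t0) ℝ) (a b c r : ℝ), r ≤ t0 →
      IntegrableOn (fun z => (1 - F2 z) * (f2 z / (1 - F2 z) *
        (DeltaFn g2 ν a + ∫ x, extD δ (a + x, b + z, c - z) ∂ν) - deriv c2 (b + z)))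
        (Ioc 0 r) := by
    intro δ a b c r hr
    have hf : IntegrableOn f2 (Ioc 0 r) := (hint r).mono_set Ioc_subset_Iic_self
    have h1 : IntegrableOn (fun z => f2 z *
        (DeltaFn g2 ν a + ∫ x, extD δ (a + x, b + z, c - z) ∂ν)) (Ioc 0 r) := by
      refine Integrable.mul_bdd (c := ‖DeltaFn g2 ν a‖ + ‖δ‖) hf ?_ (ae_of_all _ fun z => ?_)
      · exact ((stronglyMeasurable_const).add (inner_measurable δ ν a b c)).aestronglyMeasurable
      · exact (norm_add_le _ _).trans (add_le_add le_rfl (inner_bound δ ν a b c z))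
    have h2 : IntegrableOn (fun z => (1 - F2 z) * deriv c2 (b + z)) (Ioc 0 r) := by
      refine Integrable.of_bound (C := 1 * L) ?_ ?_
      · exact ((measurable_const.sub hmono.measurable).mul
          (hc2dc.measurable.comp (by fun_prop))).aestronglyMeasurable
      · filter_upwards [ae_restrict_mem measurableSet_Ioc] with z hz
        rw [norm_mul]
        refine mul_le_mul ?_ (hL _) (norm_nonneg _) zero_le_one
        have := hmono (hz.2.trans hr)
        rw [Real.norm_eq_abs, abs_le]
        constructor <;> linarith [hnn z]
    refine (h1.sub h2).congr_fun (fun z hz => ?_) measurableSet_Ioc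
    have := hmono (hz.2.trans hr)
    have h3 : 1 - F2 z ≠ 0 := by linarith
    simp only [Pi.sub_apply]
    field_simp
  have hphi : ∀ (δ η : BoundedContinuousFunction (Dset t0) ℝ) (a b c r : ℝ), r ≤ t0 →
      phiFn F2 f2 g2 c2 ν (extD δ) a b c r ≤
        phiFn F2 f2 g2 c2 ν (extD η) a b c r + F2 t0 * dist δ η := by
    intro δ η a b c r hr
    have hf : IntegrableOn f2 (Ioc 0 r) := (hint r).mono_set Ioc_subset_Iic_self
    have h1 : ∫ z in Ioc 0 r, f2 z * dist δ η ≤ F2 t0 * dist δ η := by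
      rw [integral_mul_const]
      refine mul_le_mul_of_nonneg_right ?_ dist_nonneg
      rw [hF2]
      exact setIntegral_mono_set (hint t0) (ae_of_all _ hf2nn)
        (Ioc_subset_Iic_self.trans (Iic_subset_Iic.2 hr)).eventuallyLE
    refine le_trans ?_ (add_le_add le_rfl h1)
    unfold phiFn
    rw [← integral_add (hI η a b c r hr) (hf.mul_const _)]
    refine setIntegral_mono_on (hI δ a b c r hr) ((hI η a b c r hr).add (hf.mul_const _))
      measurableSet_Ioc (fun z hz => ?_)
    have := hmono (hz.2.trans hr)
    have h3 : 1 - F2 z ≠ 0 := by linarith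
    have key : ∀ X Y : ℝ, (1 - F2 z) * (f2 z / (1 - F2 z) * X - Y)
        = f2 z * X - (1 - F2 z) * Y := by
      intro X Y
      field_simp
    simp only [key]
    have := mul_le_mul_of_nonneg_left (inner_le δ η ν a (b + z) (c - z)) (hf2nn z)
    linarith
  have hbdd : ∀ (δ : BoundedContinuousFunction (Dset t0) ℝ) (a b c : ℝ), c ≤ t0 →
      BddAbove ((fun r => phiFn F2 f2 g2 c2 ν (extD δ) a b c r) '' Icc 0 c) := by
    intro δ a b c hc
    refine ⟨∫ z in Ioc 0 c, ‖(1 - F2 z) * (f2 z / (1 - F2 z) *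
        (DeltaFn g2 ν a + ∫ x, extD δ (a + x, b + z, c - z) ∂ν) - deriv c2 (b + z))‖, ?_⟩
    · rintro _ ⟨r, hr, rfl⟩
      simp only [phiFn]
      refine (Real.le_norm_self _).trans ((norm_integral_le_integral_norm _).trans ?_)
      exact setIntegral_mono_set (hI δ a b c c hc).norm (ae_of_all _ fun z => norm_nonneg _)
        (Ioc_subset_Ioc_right hr.2).eventuallyLE
  have hle : ∀ (δ η : BoundedContinuousFunction (Dset t0) ℝ) (q : Dset t0),
      Phi δ q ≤ Phi η q + F2 t0 * dist δ η := by
    intro δ η q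
    have hc := q.2.2.2.1
    rw [hPhi, hPhi]
    refine csSup_le ((nonempty_Icc.2 hc.1).image _) ?_
    rintro _ ⟨r, hr, rfl⟩
    refine (hphi δ η _ _ _ r (hr.2.trans hc.2)).trans (add_le_add ?_ le_rfl)
    exact le_csSup (hbdd η _ _ _ hc.2) ⟨r, hr, rfl⟩
  have hcontr : ContractingWith ⟨F2 t0, hnn t0⟩ Phi := by
    refine ⟨by exact_mod_cast hF2t0, LipschitzWith.of_dist_le_mul fun δ η => ?_⟩
    refine (BoundedContinuousFunction.dist_le (mul_nonneg (hnn t0) dist_nonneg)).2 fun q => ?_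
    rw [Real.dist_eq, abs_le]
    have h1 := hle δ η q
    have h2 := hle η δ q
    rw [dist_comm η δ] at h2
    change _ ≤ _ ∧ _ ≤ F2 t0 * dist δ η
    change -(F2 t0 * dist δ η) ≤ _ ∧ _
    constructor <;> linarith
  refine ⟨⟨_, hcontr.fixedPoint_isFixedPt, fun y hy => hcontr.fixedPoint_unique hy⟩, ?_⟩
  intro y hy
  have h := hcontr.tendsto_iterate_fixedPoint 0
  rw [← hcontr.fixedPoint_unique hy] at h
  exact tendsto_iff_norm_sub_tendsto_zero.1 h
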